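/- arXiv:2203.05107 — 2 statements merged into one kernel-verified Lean document; each statement's English description precedes it below -/
import Mathlib

section
/- Let n ≥ 3 be an integer and set p₀ = n²/(n-2). Let (X, μ) be a measure space, u : X → [0,∞] measurable, p ≥ 1 a real number, and ε > 0. Then ∫_X u^{p+1} dμ ≤ (∫_X u^{p₀/2} dμ)^{2/p₀} · [ (2/n)·ε^{-((n-2)/n)²}·∫_X u^p dμ + ((n-2)/n)·ε^{2(n-2)/n²}·(∫_X u^{p·n/(n-2)} dμ)^{(n-2)/n} ], where all integrals are interpreted in the extended nonnegative reals. -/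
open MeasureTheory ENNReal

/-- Weighted Young inequality with parameter in the extended nonnegative reals. -/
lemma young_eps (b t : ℝ) (hb : 0 < b) (ht : 0 < t) (hbt : b + t = 1) (ε : ℝ) (hε : 0 < ε)
    (A B : ℝ≥0∞) :
    A ^ b * B ^ t ≤ ENNReal.ofReal (b * ε ^ (-(t ^ 2))) * A
      + ENNReal.ofReal (t * ε ^ (b * t)) * B := by
  have hc : (b⁻¹).HolderConjugate t⁻¹ := by
    rw [Real.holderConjugate_iff]
    refine ⟨(one_lt_inv₀ hb).2 (by linarith), by simpa using hbt⟩
  have h := ENNReal.young_inequality ((ENNReal.ofReal (ε ^ (-(t ^ 2))) * A) ^ b)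
    ((ENNReal.ofReal (ε ^ (b * t)) * B) ^ t) hc
  rw [← ENNReal.rpow_mul, ← ENNReal.rpow_mul, mul_inv_cancel₀ hb.ne', mul_inv_cancel₀ ht.ne',
    ENNReal.rpow_one, ENNReal.rpow_one, ENNReal.mul_rpow_of_nonneg _ _ hb.le,
    ENNReal.mul_rpow_of_nonneg _ _ ht.le, ENNReal.ofReal_rpow_of_pos (by positivity),
    ENNReal.ofReal_rpow_of_pos (by positivity), mul_mul_mul_comm,
    ← ENNReal.ofReal_mul (by positivity), ← Real.rpow_mul hε.le, ← Real.rpow_mul hε.le,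
    ← Real.rpow_add hε, show -(t ^ 2) * b + b * t * t = 0 by ring, Real.rpow_zero,
    ENNReal.ofReal_one, one_mul, ENNReal.ofReal_inv_of_pos hb, ENNReal.ofReal_inv_of_pos ht,
    div_eq_mul_inv, div_eq_mul_inv, inv_inv, inv_inv] at h
  refine h.trans (le_of_eq ?_)
  rw [ENNReal.ofReal_mul hb.le, ENNReal.ofReal_mul ht.le]
  ring


/-- The combination of (5.2) and (5.1) applied to `f = u^p`: with `p₀ = n²/(n-2)`,
`p ≥ 1` and `ε > 0`,
`∫ u^(p+1) ≤ (∫ u^(p₀/2))^(2/p₀) · [(2/n)·ε^(-((n-2)/n)²)·∫ u^p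
  + ((n-2)/n)·ε^(2(n-2)/n²)·(∫ u^(p·n/(n-2)))^((n-2)/n)]`. -/
theorem holder_moser_young (X : Type*) [MeasurableSpace X] (μ : Measure X)
    (n : ℕ) (hn : 3 ≤ n) (p₀ : ℝ) (hp₀ : p₀ = (n : ℝ) ^ 2 / ((n : ℝ) - 2))
    (u : X → ℝ≥0∞) (hu : Measurable u) (p : ℝ) (hp : 1 ≤ p) (ε : ℝ) (hε : 0 < ε) :
    ∫⁻ x, (u x) ^ (p + 1) ∂μ ≤
      (∫⁻ x, (u x) ^ (p₀ / 2) ∂μ) ^ (2 / p₀) *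
        (ENNReal.ofReal ((2 / (n : ℝ)) * ε ^ (-((((n : ℝ) - 2) / (n : ℝ)) ^ 2))) *
            ∫⁻ x, (u x) ^ p ∂μ +
          ENNReal.ofReal ((((n : ℝ) - 2) / (n : ℝ)) *
              ε ^ (2 * ((n : ℝ) - 2) / (n : ℝ) ^ 2)) *
            (∫⁻ x, (u x) ^ (p * (n : ℝ) / ((n : ℝ) - 2)) ∂μ) ^
              (((n : ℝ) - 2) / (n : ℝ))) := by
  have hn' : (3 : ℝ) ≤ n := by exact_mod_cast hn
  have hn0 : (n : ℝ) ≠ 0 := by linarith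
  have hn2 : (n : ℝ) - 2 ≠ 0 := by linarith
  have hm : 0 < (n : ℝ) - 2 := by linarith
  have hnp : 0 < (n : ℝ) := by linarith
  have hb : 0 < 2 / (n : ℝ) := by positivity
  have ht : 0 < ((n : ℝ) - 2) / n := by positivity
  have hp0 : 0 < p₀ := by rw [hp₀]; positivity
  have hy := young_eps (2 / (n : ℝ)) (((n : ℝ) - 2) / n) hb ht (by field_simp; ring) ε hε
    (∫⁻ x, (u x) ^ p ∂μ)
    ((∫⁻ x, (u x) ^ (p * (n : ℝ) / ((n : ℝ) - 2)) ∂μ) ^ (((n : ℝ) - 2) / (n : ℝ)))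
  rw [show 2 / (n : ℝ) * (((n : ℝ) - 2) / n) = 2 * ((n : ℝ) - 2) / (n : ℝ) ^ 2 by
    field_simp, ← ENNReal.rpow_mul] at hy
  refine le_trans ?_ (mul_le_mul_right hy _)
  have hH := ENNReal.lintegral_prod_norm_pow_le (μ := μ) (Finset.univ : Finset (Fin 3))
    (f := ![fun x => (u x) ^ (p₀ / 2), fun x => (u x) ^ p,
      fun x => (u x) ^ (p * (n : ℝ) / ((n : ℝ) - 2))])
    (by
      intro i _
      fin_cases i
      · exact (hu.pow_const _).aemeasurable
      · exact (hu.pow_const _).aemeasurable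
      · exact (hu.pow_const _).aemeasurable)
    (p := ![2 / p₀, 2 / (n : ℝ), (((n : ℝ) - 2) / n) * (((n : ℝ) - 2) / n)])
    (by
      simp only [Fin.sum_univ_three, Matrix.cons_val]
      rw [hp₀]; field_simp; ring)
    (by
      intro i _
      fin_cases i
      · exact (div_pos two_pos hp0).le
      · exact hb.le
      · exact (mul_pos ht ht).le)
  simp only [Fin.prod_univ_three, Matrix.cons_val] at hH
  rw [← mul_assoc]
  refine le_trans (le_of_eq (lintegral_congr fun x => ?_)) hH
  rw [← ENNReal.rpow_mul, ← ENNReal.rpow_mul, ← ENNReal.rpow_mul,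
    ← ENNReal.rpow_add_of_nonneg _ _ (by positivity) (by positivity),
    ← ENNReal.rpow_add_of_nonneg _ _ (by positivity) (by positivity)]
  congr 1
  field_simp
  ring
end

section
/- Let n ≥ 3 be an integer, set μ = 1 + 2/n, q₀ = n²/(2(n-2)), and q_k = q₀·μ^k for k ≥ 0. Then there exists a constant c(n) > 0, depending only on n, with the following property: for all real numbers K ≥ 0, L ≥ 0 and every sequence (a_k)_{k≥0} of nonnegative real numbers satisfying a_{k+1} ≤ K·μ^{k(1+n/2)}·q_k^{(n/2)(1+n/2)}·L^{1+2/n}·a_k^{1+2/n} for all k ≥ 0, one has limsup_{k→∞} a_k^{1/q_k} ≤ c(n)·K^{(n-2)/n}·L^{1-4/n²}·a_0^{1/q_0} (the limsup taken in [0,∞]). -/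
open Filter

/-- Superlinear recursion with geometric factors, in closed form. -/
theorem moser_aux (m μ A D : ℝ) (hm : 0 < m) (hmμ : m * μ = m + 1) (hμ : 0 < μ)
    (hA : 0 < A) (hD : 0 < D) (a : ℕ → ℝ) (ha : ∀ k, 0 ≤ a k)
    (h : ∀ k : ℕ, a (k + 1) ≤ A * D ^ (k : ℝ) * a k ^ μ) (k : ℕ) :
    A ^ m * D ^ ((k : ℝ) * m + m ^ 2) * a k ≤ (A ^ m * D ^ (m ^ 2) * a 0) ^ (μ ^ k) := by
  induction k with
  | zero => simp
  | succ k ih =>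
    have hp : 0 ≤ A ^ m * D ^ ((k : ℝ) * m + m ^ 2) * a k :=
      mul_nonneg (by positivity) (ha k)
    have h0 : 0 ≤ A ^ m * D ^ (m ^ 2) * a 0 := mul_nonneg (by positivity) (ha 0)
    have e1 : A ^ m * D ^ (((k + 1 : ℕ) : ℝ) * m + m ^ 2) * (A * D ^ (k : ℝ) * a k ^ μ)
        = (A ^ m * D ^ ((k : ℝ) * m + m ^ 2) * a k) ^ μ := by
      rw [Real.mul_rpow (by positivity) (ha k), Real.mul_rpow (by positivity) (by positivity),
        ← Real.rpow_mul hA.le, ← Real.rpow_mul hD.le, hmμ, Real.rpow_add hA, Real.rpow_one]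
      have : ((k : ℝ) * m + m ^ 2) * μ = (((k + 1 : ℕ) : ℝ) * m + m ^ 2) + k := by
        push_cast
        linear_combination (k + m) * hmμ
      rw [this, Real.rpow_add hD _ (k : ℝ)]
      ring
    calc _ ≤ A ^ m * D ^ (((k + 1 : ℕ) : ℝ) * m + m ^ 2) * (A * D ^ (k : ℝ) * a k ^ μ) :=
          mul_le_mul_of_nonneg_left (h k) (by positivity)
      _ = _ := e1
      _ ≤ ((A ^ m * D ^ (m ^ 2) * a 0) ^ (μ ^ k)) ^ μ := Real.rpow_le_rpow hp ih hμ.le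
      _ = _ := by rw [← Real.rpow_mul h0, pow_succ μ k]

/-- Abstract Moser iteration (the step from (5.8) to (5.9)): with `μ = 1 + 2/n`,
`q₀ = n²/(2(n-2))`, `q_k = q₀·μ^k`, there is a constant `c(n) > 0` such that for all
`K, L ≥ 0` and every nonnegative sequence `(a_k)` with
`a_{k+1} ≤ K·μ^{k(1+n/2)}·q_k^{(n/2)(1+n/2)}·L^{1+2/n}·a_k^{1+2/n}`, one has
`limsup a_k^{1/q_k} ≤ c(n)·K^{(n-2)/n}·L^{1-4/n²}·a_0^{1/q₀}` in `[0,∞]`. -/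
theorem moser_iteration (n : ℕ) (hn : 3 ≤ n) (μ q₀ : ℝ)
    (hμ : μ = 1 + 2 / (n : ℝ)) (hq₀ : q₀ = (n : ℝ) ^ 2 / (2 * ((n : ℝ) - 2)))
    (q : ℕ → ℝ) (hq : ∀ k, q k = q₀ * μ ^ k) :
    ∃ c : ℝ, 0 < c ∧
      ∀ (K L : ℝ), 0 ≤ K → 0 ≤ L → ∀ a : ℕ → ℝ, (∀ k, 0 ≤ a k) →
        (∀ k : ℕ, a (k + 1) ≤
          K * μ ^ ((k : ℝ) * (1 + (n : ℝ) / 2)) *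
            q k ^ (((n : ℝ) / 2) * (1 + (n : ℝ) / 2)) *
            L ^ (1 + 2 / (n : ℝ)) * a k ^ (1 + 2 / (n : ℝ))) →
        limsup (fun k : ℕ => ENNReal.ofReal (a k ^ (1 / q k))) atTop ≤
          ENNReal.ofReal
            (c * K ^ (((n : ℝ) - 2) / (n : ℝ)) * L ^ (1 - 4 / (n : ℝ) ^ 2) *
              a 0 ^ (1 / q₀)) := by
  have hn3 : (3 : ℝ) ≤ n := by exact_mod_cast hn
  have hn0 : (0 : ℝ) < n := by linarith
  have hn2 : (0 : ℝ) < (n : ℝ) - 2 := by linarith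
  have hμ1 : 1 < μ := by rw [hμ]; have : 0 < 2 / (n : ℝ) := by positivity
                         linarith
  have hμ0 : 0 < μ := by linarith
  have hq₀0 : 0 < q₀ := by rw [hq₀]; positivity
  have hqpos : ∀ k, 0 < q k := fun k => by rw [hq]; positivity
  obtain ⟨m, hm⟩ : ∃ m : ℝ, m = (n : ℝ) / 2 := ⟨_, rfl⟩
  have hm0 : 0 < m := by rw [hm]; positivity
  have hmμ : m * μ = m + 1 := by rw [hm, hμ]; field_simp
  have hmq : m * (1 / q₀) = ((n : ℝ) - 2) / n := by rw [hm, hq₀]; field_simp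
  have hmqL : μ * (((n : ℝ) - 2) / n) = 1 - 4 / (n : ℝ) ^ 2 := by
    rw [hμ]; field_simp; ring
  have hLpos : 0 < 1 - 4 / (n : ℝ) ^ 2 := by rw [← hmqL]; positivity
  have hKpos : 0 < ((n : ℝ) - 2) / n := by positivity
  simp only [← hm, ← hμ]
  obtain ⟨D, hDdef⟩ : ∃ D : ℝ, D = μ ^ ((1 + m) * (1 + m)) := ⟨_, rfl⟩
  obtain ⟨B, hBdef⟩ : ∃ B : ℝ, B = q₀ ^ (m * (1 + m)) := ⟨_, rfl⟩
  have hD1 : 1 ≤ D := by rw [hDdef]; exact Real.one_le_rpow hμ1.le (by positivity)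
  have hD0 : 0 < D := by linarith
  have hB0 : 0 < B := by rw [hBdef]; positivity
  have hfac : ∀ k : ℕ, μ ^ ((k : ℝ) * (1 + m)) * q k ^ (m * (1 + m)) = B * D ^ (k : ℝ) := by
    intro k
    rw [hq, Real.mul_rpow hq₀0.le (by positivity), ← Real.rpow_natCast μ k,
      ← Real.rpow_mul hμ0.le, hBdef, hDdef, ← Real.rpow_mul hμ0.le,
      mul_left_comm, ← Real.rpow_add hμ0]
    congr 2
    ring
  refine ⟨B ^ (((n : ℝ) - 2) / n) * D ^ (m ^ 2 * (1 / q₀)), by positivity, ?_⟩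
  intro K L hK hL a ha h
  have h' : ∀ k : ℕ, a (k + 1) ≤ (K * B * L ^ μ) * D ^ (k : ℝ) * a k ^ μ := by
    intro k
    refine (h k).trans (le_of_eq ?_)
    rw [mul_assoc K, hfac k]
    ring
  clear h
  by_cases hz : K = 0 ∨ L = 0
  · have hA : K * B * L ^ μ = 0 := by
      rcases hz with hz | hz
      · rw [hz]; ring
      · rw [hz, Real.zero_rpow hμ0.ne']; ring
    have hlim : Tendsto (fun k : ℕ => ENNReal.ofReal (a k ^ (1 / q k))) atTop (nhds 0) := by
      refine tendsto_const_nhds.congr' ?_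
      filter_upwards [eventually_ge_atTop 1] with k hk
      obtain ⟨j, rfl⟩ : ∃ j, k = j + 1 := ⟨k - 1, by omega⟩
      have h1 := h' j
      rw [hA] at h1
      have h2 : a (j + 1) = 0 := le_antisymm (by linarith) (ha _)
      rw [h2, Real.zero_rpow (one_div_pos.mpr (hqpos _)).ne', ENNReal.ofReal_zero]
    rw [hlim.limsup_eq]
    exact zero_le
  push Not at hz
  have hK0 : 0 < K := lt_of_le_of_ne hK (Ne.symm hz.1)
  have hL0 : 0 < L := lt_of_le_of_ne hL (Ne.symm hz.2)
  have hA0 : 0 < K * B * L ^ μ := by positivity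
  have key := moser_aux m μ (K * B * L ^ μ) D hm0 hmμ hμ0 hA0 hD0 a ha h'
  have hR : ((K * B * L ^ μ) ^ m * D ^ (m ^ 2) * a 0) ^ (1 / q₀) =
      B ^ (((n : ℝ) - 2) / n) * D ^ (m ^ 2 * (1 / q₀)) * K ^ (((n : ℝ) - 2) / n) *
        L ^ (1 - 4 / (n : ℝ) ^ 2) * a 0 ^ (1 / q₀) := by
    rw [Real.mul_rpow (by positivity) (ha 0), Real.mul_rpow (by positivity) (by positivity),
      ← Real.rpow_mul hA0.le, ← Real.rpow_mul hD0.le, hmq,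
      Real.mul_rpow (by positivity) (by positivity), Real.mul_rpow hK hB0.le,
      ← Real.rpow_mul hL, hmqL]
    ring
  rw [← hR]
  generalize K * B * L ^ μ = A at *
  have h00 : 0 ≤ A ^ m * D ^ (m ^ 2) * a 0 := mul_nonneg (by positivity) (ha 0)
  generalize A ^ m * D ^ (m ^ 2) * a 0 = X at *
  have hbd : ∀ k : ℕ, a k ^ (1 / q k) ≤ (A ^ m) ^ (-(1 / q k)) * X ^ (1 / q₀) := by
    intro k
    have hq' := one_div_pos.mpr (hqpos k)
    have h1 : A ^ m * a k ≤ X ^ (μ ^ k) := by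
      refine le_trans ?_ (key k)
      refine mul_le_mul_of_nonneg_right ?_ (ha k)
      exact le_mul_of_one_le_right (by positivity) (Real.one_le_rpow hD1 (by positivity))
    have h2 := Real.rpow_le_rpow (mul_nonneg (by positivity) (ha k)) h1 hq'.le
    have e : μ ^ k * (1 / q k) = 1 / q₀ := by rw [hq]; field_simp
    rw [Real.mul_rpow (by positivity) (ha k), ← Real.rpow_mul h00, e] at h2
    rw [Real.rpow_neg (by positivity)]
    rwa [inv_mul_eq_div, le_div_iff₀' (by positivity)]
  have hq_lim : Tendsto (fun k : ℕ => -(1 / q k)) atTop (nhds 0) := by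
    have h1 : Tendsto q atTop atTop := by
      have : q = fun k => q₀ * μ ^ k := funext hq
      rw [this]
      exact (tendsto_pow_atTop_atTop_of_one_lt hμ1).const_mul_atTop hq₀0
    have := (tendsto_inv_atTop_zero.comp h1).neg
    simpa [Function.comp_def] using this
  have hlim : Tendsto (fun k : ℕ => ENNReal.ofReal ((A ^ m) ^ (-(1 / q k)) * X ^ (1 / q₀)))
      atTop (nhds (ENNReal.ofReal (X ^ (1 / q₀)))) := by
    apply ENNReal.tendsto_ofReal
    have hAm : 0 < A ^ m := by positivity
    have h1 := (tendsto_const_nhds (x := A ^ m) |>.rpow hq_lim (Or.inl hAm.ne')).mul_const (X ^ (1 / q₀))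
    simpa using h1
  rw [← hlim.limsup_eq]
  exact limsup_le_limsup (Eventually.of_forall fun k => ENNReal.ofReal_le_ofReal (hbd k))
end
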